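/- Let q ∈ ℝ with q ≠ 0. Then for every x, y, ρ ∈ ℝ and every integer n ≥ 1: Σ_{j=0}^{n} [n choose j]_q · p_j(x|y,ρ,q) · g_{n−j}(x|y,ρ,q) = 0. -/

import Mathlib

open Finset

section Defs

variable {K : Type*} [Field K]

/-- q-Pochhammer symbol `(a; q)_n = ∏_{j=0}^{n-1} (1 - a q^j)`. -/
def qPoch (a q : K) (n : ℕ) : K := ∏ j ∈ Finset.range n, (1 - a * q ^ j)

/-- Gaussian (q-binomial) coefficient `[n choose k]_q`. -/
def qBinom (q : K) : ℕ → ℕ → K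
  | _, 0 => 1
  | 0, _ + 1 => 0
  | n + 1, k + 1 => qBinom q n k + q ^ (k + 1) * qBinom q n (k + 1)

/-- Continuous q-Hermite polynomials `h_n(x|q)`:
`h_{-1} = 0`, `h_0 = 1`, `h_{n+1} = 2x h_n - (1 - q^n) h_{n-1}`. -/
def hQH (q x : K) : ℕ → K
  | 0 => 1
  | 1 => 2 * x
  | n + 2 => 2 * x * hQH q x (n + 1) - (1 - q ^ (n + 1)) * hQH q x n

/-- The polynomials `b_n(x|q) = (-1)^n q^{n(n-1)/2} h_n(x|q^{-1})` (for `q ≠ 0`). -/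
def bQH (q x : K) (n : ℕ) : K := (-1) ^ n * q ^ (n * (n - 1) / 2) * hQH q⁻¹ x n

/-- Al-Salam–Chihara polynomials in conjugate-pair parametrization `p_n(x|y,ρ,q)`:
`p_{-1} = 0`, `p_0 = 1`,
`p_{n+1} = 2(x - ρ y q^n) p_n - (1 - q^n)(1 - ρ² q^{n-1}) p_{n-1}`. -/
def pASC (q x y ρ : K) : ℕ → K
  | 0 => 1
  | 1 => 2 * (x - ρ * y)
  | n + 2 => 2 * (x - ρ * y * q ^ (n + 1)) * pASC q x y ρ (n + 1)
      - (1 - q ^ (n + 1)) * (1 - ρ ^ 2 * q ^ n) * pASC q x y ρ n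

open Classical in
/-- The polynomials `g_n(x|y,ρ,q)`: `ρ^n p_n(y|x,ρ⁻¹,q)` for `ρ ≠ 0`, `b_n(x|q)` for `ρ = 0`. -/
noncomputable def gASC (q x y ρ : K) (n : ℕ) : K :=
  if ρ = 0 then bQH q x n else ρ ^ n * pASC q y x ρ⁻¹ n

/-- `ω(u,v|ρ) = (1-ρ²)² - 4uvρ(1+ρ²) + 4ρ²(u²+v²)`. -/
def omegaW (u v ρ : K) : K :=
  (1 - ρ ^ 2) ^ 2 - 4 * u * v * ρ * (1 + ρ ^ 2) + 4 * ρ ^ 2 * (u ^ 2 + v ^ 2)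

/-- `v(x|t) = 1 - 2xt + t²`. -/
def vQH (x t : K) : K := 1 - 2 * x * t + t ^ 2

/-- Coefficient `e_n(a,b,c,d,q)` of the Askey–Wilson three-term recurrence. -/
def eAW (a b c d q : K) (n : ℕ) : K :=
  q ^ ((n : ℤ) - 2) /
      ((1 - a * b * c * d * q ^ (2 * (n : ℤ) - 2)) * (1 - a * b * c * d * q ^ (2 * (n : ℤ)))) *
    ((a + b + c + d) * (q ^ 2 - a * b * c * d * q ^ (n : ℤ) * (1 + q - q ^ ((n : ℤ) + 1))) +
      (a * b * c + a * b * d + a * c * d + b * c * d) *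
        (q - q ^ ((n : ℤ) + 2) - q ^ ((n : ℤ) + 1) + a * b * c * d * q ^ (2 * (n : ℤ))))

/-- Coefficient `f_n(a,b,c,d,q)` of the Askey–Wilson three-term recurrence. -/
def fAW (a b c d q : K) (n : ℕ) : K :=
  (1 - q ^ (n : ℤ)) * (1 - a * b * q ^ ((n : ℤ) - 1)) * (1 - a * c * q ^ ((n : ℤ) - 1)) *
      (1 - a * d * q ^ ((n : ℤ) - 1)) * (1 - b * c * q ^ ((n : ℤ) - 1)) *
      (1 - b * d * q ^ ((n : ℤ) - 1)) * (1 - c * d * q ^ ((n : ℤ) - 1)) *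
      (1 - a * b * c * d * q ^ ((n : ℤ) - 2)) /
    (qPoch (a * b * c * d * q ^ (2 * (n : ℤ) - 3)) q 3 *
      (1 - a * b * c * d * q ^ (2 * (n : ℤ) - 2)))

/-- Monic Askey–Wilson polynomials `α_n(x|a,b,c,d,q)`:
`α_{-1} = 0`, `α_0 = 1`, `α_{n+1} = (2x - e_n) α_n - f_n α_{n-1}`. -/
def alphaAW (a b c d q x : K) : ℕ → K
  | 0 => 1
  | 1 => 2 * x - eAW a b c d q 0
  | n + 2 => (2 * x - eAW a b c d q (n + 1)) * alphaAW a b c d q x (n + 1) -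
      fAW a b c d q (n + 1) * alphaAW a b c d q x n

/-- Coefficient of `ψ_n` in the continuous dual Hahn recurrence:
`q^n (b+c+d) + bcd q^{n-1} (1 - q^{n+1} - q^n)`. -/
def ePsi (b c d q : K) (n : ℕ) : K :=
  q ^ (n : ℤ) * (b + c + d) + b * c * d * q ^ ((n : ℤ) - 1) * (1 - q ^ ((n : ℤ) + 1) - q ^ (n : ℤ))

/-- Coefficient of `ψ_{n-1}` in the continuous dual Hahn recurrence:
`(1-q^n)(1-bcq^{n-1})(1-bdq^{n-1})(1-cdq^{n-1})`. -/
def fPsi (b c d q : K) (n : ℕ) : K :=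
  (1 - q ^ (n : ℤ)) * (1 - b * c * q ^ ((n : ℤ) - 1)) * (1 - b * d * q ^ ((n : ℤ) - 1)) *
    (1 - c * d * q ^ ((n : ℤ) - 1))

/-- Continuous dual Hahn polynomials `ψ_n(x|b,c,d,q)`:
`ψ_{-1} = 0`, `ψ_0 = 1`, `ψ_{n+1} = (2x - ePsi_n) ψ_n - fPsi_n ψ_{n-1}`. -/
def psiCDH (b c d q x : K) : ℕ → K
  | 0 => 1
  | 1 => 2 * x - ePsi b c d q 0
  | n + 2 => (2 * x - ePsi b c d q (n + 1)) * psiCDH b c d q x (n + 1) -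
      fPsi b c d q (n + 1) * psiCDH b c d q x n

/-- Al-Salam–Chihara polynomials `Q_n(x|c,d,q)`:
`Q_{-1} = 0`, `Q_0 = 1`, `Q_{n+1} = (2x - q^n(c+d)) Q_n - (1-q^n)(1-cdq^{n-1}) Q_{n-1}`. -/
def qASC (c d q x : K) : ℕ → K
  | 0 => 1
  | 1 => 2 * x - (c + d)
  | n + 2 => (2 * x - q ^ (n + 1) * (c + d)) * qASC c d q x (n + 1) -
      (1 - q ^ (n + 1)) * (1 - c * d * q ^ n) * qASC c d q x n

/-- Coefficient `ẽ_n` of the conjugate-pair Askey–Wilson recurrence. -/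
def eW (y ρ₁ z ρ₂ q : K) (n : ℕ) : K :=
  2 * q ^ ((n : ℤ) - 1) /
      ((1 - ρ₁ ^ 2 * ρ₂ ^ 2 * q ^ (2 * (n : ℤ) - 2)) *
        (1 - ρ₁ ^ 2 * ρ₂ ^ 2 * q ^ (2 * (n : ℤ)))) *
    (q * (ρ₁ * y + ρ₂ * z) *
        (1 - ρ₁ ^ 2 * ρ₂ ^ 2 * q ^ ((n : ℤ) - 2) * (1 + q - q ^ ((n : ℤ) + 1))) +
      ρ₁ * ρ₂ * (ρ₁ * z + ρ₂ * y) *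
        (1 - q ^ ((n : ℤ) + 1) - q ^ (n : ℤ) + ρ₁ ^ 2 * ρ₂ ^ 2 * q ^ (2 * (n : ℤ) - 1)))

/-- Coefficient `f̃_n` of the conjugate-pair Askey–Wilson recurrence. -/
def fW (y ρ₁ z ρ₂ q : K) (n : ℕ) : K :=
  (1 - q ^ (n : ℤ)) * omegaW y z (ρ₁ * ρ₂ * q ^ ((n : ℤ) - 1)) *
      (1 - ρ₁ ^ 2 * q ^ ((n : ℤ) - 1)) * (1 - ρ₂ ^ 2 * q ^ ((n : ℤ) - 1)) *
      (1 - ρ₁ ^ 2 * ρ₂ ^ 2 * q ^ ((n : ℤ) - 2)) /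
    (qPoch (ρ₁ ^ 2 * ρ₂ ^ 2 * q ^ (2 * (n : ℤ) - 3)) q 3 *
      (1 - ρ₁ ^ 2 * ρ₂ ^ 2 * q ^ (2 * (n : ℤ) - 2)))

/-- Conjugate-pair Askey–Wilson polynomials `w_n(x|y,ρ₁,z,ρ₂,q)`:
`w_{-1} = 0`, `w_0 = 1`, `w_{n+1} = (2x - ẽ_n) w_n - f̃_n w_{n-1}`. -/
def wAW (x y ρ₁ z ρ₂ q : K) : ℕ → K
  | 0 => 1
  | 1 => 2 * x - eW y ρ₁ z ρ₂ q 0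
  | n + 2 => (2 * x - eW y ρ₁ z ρ₂ q (n + 1)) * wAW x y ρ₁ z ρ₂ q (n + 1) -
      fW y ρ₁ z ρ₂ q (n + 1) * wAW x y ρ₁ z ρ₂ q n

/-- Chebyshev polynomials of the second kind. -/
def chebU (x : K) : ℕ → K
  | 0 => 1
  | 1 => 2 * x
  | n + 2 => 2 * x * chebU x (n + 1) - chebU x n

/-- The quantity `A_n` from the Askey–Wilson recurrence factorization. -/
def A_AW (a b c d q : K) (n : ℕ) : K :=
  (1 - a * b * q ^ (n : ℤ)) * (1 - a * c * q ^ (n : ℤ)) * (1 - a * d * q ^ (n : ℤ)) *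
      (1 - a * b * c * d * q ^ ((n : ℤ) - 1)) /
    (a * (1 - a * b * c * d * q ^ (2 * (n : ℤ) - 1)) * (1 - a * b * c * d * q ^ (2 * (n : ℤ))))

/-- The quantity `C_n` from the Askey–Wilson recurrence factorization. -/
def C_AW (a b c d q : K) (n : ℕ) : K :=
  a * (1 - q ^ (n : ℤ)) * (1 - b * c * q ^ ((n : ℤ) - 1)) * (1 - b * d * q ^ ((n : ℤ) - 1)) *
      (1 - c * d * q ^ ((n : ℤ) - 1)) /
    ((1 - a * b * c * d * q ^ (2 * (n : ℤ) - 2)) * (1 - a * b * c * d * q ^ (2 * (n : ℤ) - 1)))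

end Defs

section ThreeTerm

variable {K : Type*} [Field K]

/-- The solution of
`s_{n+1} = (a - b q^n) s_n - (1 - q^n)(c - d q^{n-1}) s_{n-1}`, `s_{-1} = 0`, `s_0 = 1`. -/
def qThreeTerm (q a b c d : K) : ℕ → K
  | 0 => 1
  | 1 => a - b
  | n + 2 => (a - b * q ^ (n + 1)) * qThreeTerm q a b c d (n + 1)
      - (1 - q ^ (n + 1)) * (c - d * q ^ n) * qThreeTerm q a b c d n

lemma pASC_eq_qThreeTerm (q x y ρ : K) (n : ℕ) :
    pASC q x y ρ n = qThreeTerm q (2 * x) (2 * (ρ * y)) 1 (ρ ^ 2) n := by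
  induction n using Nat.twoStepInduction with
  | zero => rfl
  | one => simp only [pASC, qThreeTerm]; ring
  | more n ih₀ ih₁ => simp only [pASC, qThreeTerm, ih₀, ih₁]; ring

lemma bQH_add_two {q : K} (hq : q ≠ 0) (x : K) (n : ℕ) :
    bQH q x (n + 2) = -(2 * x * q ^ (n + 1)) * bQH q x (n + 1)
      + (1 - q ^ (n + 1)) * q ^ n * bQH q x n := by
  have h₁ : (n + 1) * (n + 1 - 1) / 2 = n * (n - 1) / 2 + n := by
    simpa [Finset.sum_range_id] using Finset.sum_range_succ (fun i : ℕ => i) n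
  have h₂ : (n + 2) * (n + 2 - 1) / 2 = n * (n - 1) / 2 + n + (n + 1) := by
    have := Finset.sum_range_succ (fun i : ℕ => i) (n + 1)
    rw [Finset.sum_range_id, Finset.sum_range_id, h₁] at this
    exact this
  have hn : q ^ (n + 1) ≠ 0 := pow_ne_zero _ hq
  simp only [bQH, hQH, h₁, h₂, inv_pow]
  rw [pow_add q (n * (n - 1) / 2 + n) (n + 1), pow_add q (n * (n - 1) / 2) n]
  field_simp
  ring

lemma gASC_eq_qThreeTerm {q : K} (hq : q ≠ 0) (x y ρ : K) (n : ℕ) :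
    gASC q x y ρ n = qThreeTerm q (2 * (ρ * y)) (2 * x) (ρ ^ 2) 1 n := by
  by_cases hρ : ρ = 0
  · subst hρ
    simp only [gASC, if_true]
    induction n using Nat.twoStepInduction with
    | zero => simp [bQH, hQH, qThreeTerm]
    | one => simp [bQH, hQH, qThreeTerm]
    | more n ih₀ ih₁ => rw [bQH_add_two hq, ih₀, ih₁]; simp only [qThreeTerm]; ring
  · simp only [gASC, if_neg hρ]
    induction n using Nat.twoStepInduction with
    | zero => simp [pASC, qThreeTerm]
    | one => simp only [pASC, qThreeTerm]; field_simp
    | more n ih₀ ih₁ =>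
      simp only [qThreeTerm, ← ih₀, ← ih₁, pASC]
      field_simp
      ring

lemma qBinom_eq_zero_of_lt (q : K) {n k : ℕ} (h : n < k) : qBinom q n k = 0 := by
  induction n generalizing k with
  | zero => obtain ⟨k, rfl⟩ := Nat.exists_eq_succ_of_ne_zero h.ne'; rfl
  | succ n ih =>
    obtain ⟨k, rfl⟩ := Nat.exists_eq_succ_of_ne_zero (Nat.ne_of_gt (Nat.zero_lt_of_lt h))
    simp [qBinom, ih (show n < k by omega), ih (show n < k + 1 by omega)]

lemma qPoch_succ (a q : K) (n : ℕ) : qPoch a q (n + 1) = qPoch a q n * (1 - a * q ^ n) :=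
  Finset.prod_range_succ _ _

lemma qBinom_mul_qPoch (q : K) (i j : ℕ) :
    qBinom q (i + j) i * (qPoch q q i * qPoch q q j) = qPoch q q (i + j) := by
  induction h : i + j generalizing i j with
  | zero =>
    obtain ⟨rfl, rfl⟩ : i = 0 ∧ j = 0 := by omega
    simp [qBinom, qPoch]
  | succ n ih =>
    rcases i with _ | i
    · obtain rfl : j = n + 1 := by omega
      simp [qBinom, qPoch]
    · have h₁ := ih i j (by omega)
      have h₂ : qBinom q n (i + 1) * (qPoch q q (i + 1) * qPoch q q j)
          = (1 - q ^ j) * qPoch q q n := by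
        rcases j with _ | j
        · simp [qBinom_eq_zero_of_lt q (show n < i + 1 by omega)]
        · rw [← ih (i + 1) j (by omega), qPoch_succ q q j]
          ring
      have hn : q ^ n = q ^ i * q ^ j := by rw [← pow_add]; congr 1; omega
      rw [qPoch_succ q q i] at h₂ ⊢
      rw [qPoch_succ q q n, hn]
      simp only [qBinom]
      linear_combination (1 - q * q ^ i) * h₁ + q ^ (i + 1) * h₂

lemma qPoch_self_ne_zero {q : K} (hq : ∀ n : ℕ, q ^ (n + 1) ≠ 1) (n : ℕ) :
    qPoch q q n ≠ 0 :=
  Finset.prod_ne_zero_iff.2 fun j _ => by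
    rw [← pow_succ', sub_ne_zero]
    exact (hq j).symm

/-- The generating function `∑ s_n tⁿ / (q; q)_n` of `qThreeTerm`. -/
noncomputable def qThreeTermGen (q a b c d : K) : PowerSeries K :=
  PowerSeries.mk fun n => qThreeTerm q a b c d n / qPoch q q n

lemma qThreeTerm_div_qPoch_add_two {q : K} (hq : ∀ n : ℕ, q ^ (n + 1) ≠ 1) (a b c d : K) (n : ℕ) :
    (1 - q ^ (n + 2)) * (qThreeTerm q a b c d (n + 2) / qPoch q q (n + 2)) =
      (a - b * q ^ (n + 1)) * (qThreeTerm q a b c d (n + 1) / qPoch q q (n + 1))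
        - (c - d * q ^ n) * (qThreeTerm q a b c d n / qPoch q q n) := by
  have h₀ := qPoch_self_ne_zero hq n
  have h₁ : 1 - q ^ (n + 1) ≠ 0 := sub_ne_zero.2 (hq n).symm
  have h₂ : 1 - q ^ (n + 2) ≠ 0 := sub_ne_zero.2 (hq (n + 1)).symm
  rw [qPoch_succ q q (n + 1), qPoch_succ q q n, ← pow_succ', ← pow_succ', qThreeTerm]
  generalize a - b * q ^ (n + 1) = A
  generalize 1 - q ^ (n + 1) = u at *
  generalize 1 - q ^ (n + 2) = w at *
  field_simp

open PowerSeries in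
lemma qThreeTermGen_mul {q : K} (hq : ∀ n : ℕ, q ^ (n + 1) ≠ 1) (a b c d : K) :
    (1 - X * (C a - X * C c)) * qThreeTermGen q a b c d =
      (1 - X * (C b - X * C d)) * rescale q (qThreeTermGen q a b c d) := by
  simp only [sub_mul, one_mul, mul_assoc]
  ext n
  rcases n with _ | _ | n
  · simp only [map_sub, coeff_zero_X_mul, coeff_rescale]
    simp
  · have h₀ : 1 - q ≠ 0 := by simpa [sub_ne_zero] using (hq 0).symm
    simp only [qThreeTermGen, map_sub, coeff_succ_X_mul, coeff_zero_X_mul, coeff_C_mul,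
      coeff_rescale, coeff_mk, qThreeTerm, qPoch]
    simp
    field_simp
    ring
  · simp only [qThreeTermGen, map_sub, coeff_succ_X_mul, coeff_C_mul, coeff_rescale, coeff_mk]
    linear_combination qThreeTerm_div_qPoch_add_two hq a b c d n

open PowerSeries in
lemma sum_qBinom_mul_qThreeTerm_of_pow_ne_one {q : K} (hq : ∀ n : ℕ, q ^ (n + 1) ≠ 1)
    (a b c d : K) (n : ℕ) :
    ∑ j ∈ Finset.range (n + 1 + 1),
      qBinom q (n + 1) j * qThreeTerm q a b c d j * qThreeTerm q b a d c (n + 1 - j) = 0 := by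
  set P := qThreeTermGen q a b c d with hP
  set G := qThreeTermGen q b a d c with hG
  have hne (u v : K) : (1 - X * (C u - X * C v) : PowerSeries K) ≠ 0 := fun h => by
    simpa using congrArg (constantCoeff (R := K)) h
  have hPG : P * G = rescale q (P * G) := by
    refine mul_left_cancel₀ (mul_ne_zero (hne a c) (hne b d)) ?_
    have h₁ := qThreeTermGen_mul hq a b c d
    have h₂ := qThreeTermGen_mul hq b a d c
    rw [map_mul]
    calc _ = ((1 - X * (C a - X * C c)) * P) * ((1 - X * (C b - X * C d)) * G) := by ring
      _ = _ := by rw [h₁, h₂]; ring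
  have hc : coeff (n + 1) (P * G) = 0 := by
    have h := congrArg (coeff (n + 1)) hPG
    rw [coeff_rescale] at h
    have : (1 - q ^ (n + 1)) * coeff (n + 1) (P * G) = 0 := by linear_combination h
    exact (mul_eq_zero.1 this).resolve_left (sub_ne_zero.2 (hq n).symm)
  rw [coeff_mul, Finset.Nat.sum_antidiagonal_eq_sum_range_succ_mk] at hc
  rw [← mul_zero (qPoch q q (n + 1)), ← hc, Finset.mul_sum]
  refine Finset.sum_congr rfl fun j hj => ?_
  have hj : j + (n + 1 - j) = n + 1 := by have := Finset.mem_range.1 hj; omega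
  have hb := qBinom_mul_qPoch q j (n + 1 - j)
  rw [hj] at hb
  have h₁ := qPoch_self_ne_zero hq j
  have h₂ := qPoch_self_ne_zero hq (n + 1 - j)
  simp only [hP, hG, qThreeTermGen, coeff_mk]
  rw [← hb]
  field_simp

end ThreeTerm

lemma continuous_qBinom (n k : ℕ) : Continuous fun q : ℝ => qBinom q n k := by
  induction n generalizing k with
  | zero => cases k <;> exact continuous_const
  | succ n ih =>
    cases k with
    | zero => exact continuous_const
    | succ k => exact (ih k).add ((continuous_pow _).mul (ih (k + 1)))

lemma continuous_qThreeTerm (a b c d : ℝ) (n : ℕ) :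
    Continuous fun q : ℝ => qThreeTerm q a b c d n := by
  induction n using Nat.twoStepInduction with
  | zero => exact continuous_const
  | one => exact continuous_const
  | more n ih₀ ih₁ => simp only [qThreeTerm]; fun_prop

lemma sum_qBinom_mul_qThreeTerm (q a b c d : ℝ) (n : ℕ) :
    ∑ j ∈ Finset.range (n + 1 + 1),
      qBinom q (n + 1) j * qThreeTerm q a b c d j * qThreeTerm q b a d c (n + 1 - j) = 0 := by
  have hdense : Dense ({1, -1} : Set ℝ)ᶜ :=
    (Set.toFinite ({1, -1} : Set ℝ)).countable.dense_compl ℝ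
  have hcont : Continuous fun q : ℝ => ∑ j ∈ Finset.range (n + 1 + 1),
      qBinom q (n + 1) j * qThreeTerm q a b c d j * qThreeTerm q b a d c (n + 1 - j) :=
    continuous_finsetSum _ fun j _ =>
      ((continuous_qBinom _ _).mul (continuous_qThreeTerm ..)).mul (continuous_qThreeTerm ..)
  refine congrFun (hcont.ext_on hdense (continuous_const (y := (0 : ℝ))) fun r hr => ?_) q
  refine sum_qBinom_mul_qThreeTerm_of_pow_ne_one (fun m hm => hr ?_) a b c d n
  rcases (pow_eq_one_iff_cases.1 hm) with h | h | h
  · omega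
  · exact Or.inl h
  · exact Or.inr h.1

/-- Proposition: `∑_{j=0}^n [n choose j]_q p_j(x|y,ρ,q) g_{n-j}(x|y,ρ,q) = 0` for `n ≥ 1`. -/
theorem pASC_gASC_convolution (q : ℝ) (hq : q ≠ 0) (x y ρ : ℝ) (n : ℕ) (hn : 1 ≤ n) :
    ∑ j ∈ Finset.range (n + 1),
      qBinom q n j * pASC q x y ρ j * gASC q x y ρ (n - j) = 0 := by
  obtain ⟨n, rfl⟩ := Nat.exists_eq_add_of_le' hn
  simp only [pASC_eq_qThreeTerm, gASC_eq_qThreeTerm hq]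
  exact sum_qBinom_mul_qThreeTerm ..
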